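/- Let μ ∈ ℝ^d and X = μ + √W · A Z. Then (i) pointwise on Ω, the squared Mahalanobis distance satisfies D²(X; μ, Σ) = W · ∑_{i=1}^d Zᵢ²; and (ii) for every x ≥ 0, ℙ(D²(X; μ, Σ) ≤ x) = ∫₀^∞ G_{d/2, 1/2}((−∞, x/w]) dρ_W(w), where ρ_W is the law of W and G_{d/2, 1/2} denotes the gamma distribution with shape d/2 and rate 1/2. That is, the distribution function of the squared Mahalanobis distance of a normal variance mixture is the mixture of scaled gamma (chi-squared) distribution functions. -/

import Mathlib

open Real Set Matrix MeasureTheory ProbabilityTheory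


lemma aux_one (t : ℝ) : ∫ x, exp (t * x ^ 2) ∂(gaussianReal 0 1) =
    (√(2 * π))⁻¹ * √(π / (1 / 2 - t)) := by
  rw [integral_gaussianReal_eq_integral_smul (by simp), ← integral_gaussian, ← integral_const_mul]
  congr with x
  simp only [gaussianPDFReal, smul_eq_mul, mul_assoc, ← exp_add]
  simp
  left
  ring

lemma aux_mgf_gauss (d : ℕ) (t : ℝ) :
    mgf (fun z : Fin d → ℝ => ∑ i, z i ^ 2) (Measure.pi fun _ : Fin d => gaussianReal 0 1) t =
    ((√(2 * π))⁻¹ * √(π / (1 / 2 - t))) ^ d := by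
  simp only [mgf, Finset.mul_sum, exp_sum]
  rw [integral_fintype_prod_eq_prod (f := fun (_ : Fin d) (x : ℝ) => exp (t * x ^ 2))]
  simp [aux_one]

lemma aux_mgf_gamma_eq (a t : ℝ) (ha : 0 < a) :
    mgf id (gammaMeasure a (1 / 2)) t =
      (1 / 2) ^ a / Gamma a * ∫ x in Ioi 0, x ^ (a - 1) * exp (- ((1 / 2 - t) * x)) := by
  simp only [mgf, gammaMeasure]
  rw [integral_withDensity_eq_integral_toReal_smul
    (f := gammaPDF a (1 / 2)) (measurable_gammaPDFReal a (1/2)).ennreal_ofReal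
    (by simp [gammaPDF]),
    ← integral_const_mul, ← integral_Ici_eq_integral_Ioi, ← integral_indicator measurableSet_Ici]
  congr with x
  rw [gammaPDF, ENNReal.toReal_ofReal (gammaPDFReal_nonneg ha (by norm_num) x)]
  by_cases hx : 0 ≤ x
  · simp only [gammaPDFReal, hx, if_true, smul_eq_mul, mem_Ici, indicator_of_mem, mul_assoc,
      ← exp_add, id]
    congr 3
    ring_nf
  · simp [gammaPDFReal, hx]

lemma aux_mgf_gamma_pos (a t : ℝ) (ha : 0 < a) (ht : t < 1 / 2) :
    mgf id (gammaMeasure a (1 / 2)) t = (1 / 2) ^ a * (1 / (1 / 2 - t)) ^ a := by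
  rw [aux_mgf_gamma_eq a t ha, integral_rpow_mul_exp_neg_mul_Ioi ha (by linarith)]
  have := (Gamma_pos_of_pos ha).ne'
  field_simp

lemma aux_mgf_gamma_zero (a t : ℝ) (ha : 0 < a) (ht : 1 / 2 ≤ t) :
    mgf id (gammaMeasure a (1 / 2)) t = 0 := by
  rw [aux_mgf_gamma_eq a t ha, integral_undef, mul_zero]
  intro h
  have h1 : IntegrableOn (fun x : ℝ => x ^ (a - 1)) (Ioi 1) := by
    refine Integrable.mono' (IntegrableOn.mono_set h (Ioi_subset_Ioi zero_le_one)) ?_ ?_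
    · exact (measurable_id.pow_const _).aestronglyMeasurable
    · filter_upwards [ae_restrict_mem measurableSet_Ioi] with x hx
      have hx0 : (0:ℝ) < x := lt_trans one_pos hx
      have : 0 < x ^ (a - 1) := rpow_pos_of_pos hx0 _
      rw [norm_of_nonneg this.le]
      refine le_mul_of_one_le_right this.le (one_le_exp ?_)
      nlinarith
  rw [integrableOn_Ioi_rpow_iff one_pos] at h1
  linarith

lemma aux_law (d : ℕ) (hd : 1 ≤ d) :
    Measure.map (fun z : Fin d → ℝ => ∑ i, z i ^ 2) (Measure.pi fun _ : Fin d => gaussianReal 0 1)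
      = gammaMeasure ((d : ℝ) / 2) (1 / 2) := by
  have hdp : (0 : ℝ) < d := by exact_mod_cast hd
  have ha : (0 : ℝ) < d / 2 := by positivity
  have : IsProbabilityMeasure (gammaMeasure ((d : ℝ) / 2) (1 / 2)) :=
    isProbabilityMeasure_gammaMeasure ha (by norm_num)
  have hm : Measurable (fun z : Fin d → ℝ => ∑ i, z i ^ 2) := by fun_prop
  have hmgf : mgf (fun z : Fin d → ℝ => ∑ i, z i ^ 2)
      (Measure.pi fun _ : Fin d => gaussianReal 0 1)
      = mgf id (gammaMeasure ((d : ℝ) / 2) (1 / 2)) := by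
    ext t
    rw [aux_mgf_gauss]
    rcases lt_or_ge t (1 / 2) with ht | ht
    · rw [aux_mgf_gamma_pos _ _ ha ht]
      have hb : 0 < 1 / 2 - t := by linarith
      rw [← mul_rpow (by norm_num) (by positivity), ← sqrt_inv, ← sqrt_mul (by positivity),
        sqrt_eq_rpow, ← rpow_natCast, ← rpow_mul (by positivity)]
      congr 1
      · field_simp
      · ring
    · rw [aux_mgf_gamma_zero _ _ ha ht, sqrt_eq_zero_of_nonpos (x := π / (1 / 2 - t)), mul_zero,
        zero_pow (by omega)]
      exact div_nonpos_of_nonneg_of_nonpos pi_pos.le (by linarith)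
  have hE := eqOn_complexMGF_of_mgf hmgf
  have h0 : (0 : ℝ) ∈ interior (integrableExpSet (fun z : Fin d → ℝ => ∑ i, z i ^ 2)
      (Measure.pi fun _ : Fin d => gaussianReal 0 1)) := by
    rw [mem_interior]
    refine ⟨Iio (1 / 2), fun t ht => ?_, isOpen_Iio, by simp⟩
    have hb : 0 < 1 / 2 - t := by simp at ht ⊢; linarith
    refine mgf_pos_iff.1 ?_
    rw [aux_mgf_gauss]
    positivity
  have : IsProbabilityMeasure (Measure.map (fun z : Fin d → ℝ => ∑ i, z i ^ 2)
      (Measure.pi fun _ : Fin d => gaussianReal 0 1)) :=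
    Measure.isProbabilityMeasure_map hm.aemeasurable
  refine Measure.ext_of_charFun (funext fun t => ?_)
  have := hE (x := t * Complex.I) (by simpa using h0)
  rw [charFun_apply_real, charFun_apply_real, integral_map hm.aemeasurable (by fun_prop)]
  simp only [complexMGF, id] at this
  convert this using 3 <;> (congr 1; ring)

/-- For the normal variance mixture `X = μ + √W · A Z` with `Σ = A Aᵀ`:
(i) whenever `W ω ≥ 0` (which holds almost surely), the squared Mahalanobis distance
satisfies `D²(X ω; μ, Σ) = W ω * ∑ i, (Z ω i)²`; and (ii) for every `x ≥ 0`,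
`ℙ(D²(X; μ, Σ) ≤ x) = ∫₀^∞ G_{d/2,1/2}((-∞, x/w]) dρ_W(w)`, the mixture of scaled
gamma (chi-squared) distribution functions. -/
theorem stmt_14 (d : ℕ) (hd : 1 ≤ d)
    {Ω : Type*} [MeasureSpace Ω] [IsProbabilityMeasure (ℙ : Measure Ω)]
    (W : Ω → ℝ) (hW : Measurable W) (hWpos : ∀ᵐ ω ∂ℙ, 0 < W ω)
    (Z : Ω → Fin d → ℝ) (hZ : Measurable Z)
    (hZlaw : Measure.map Z ℙ = Measure.pi fun _ : Fin d => gaussianReal 0 1)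
    (hindep : IndepFun W Z ℙ)
    (A : Matrix (Fin d) (Fin d) ℝ) (hA : IsUnit A.det)
    (S : Matrix (Fin d) (Fin d) ℝ) (hSdef : S = A * Aᵀ)
    (μ : Fin d → ℝ)
    (X : Ω → Fin d → ℝ)
    (hX : ∀ ω, X ω = μ + Real.sqrt (W ω) • A.mulVec (Z ω))
    (D2 : (Fin d → ℝ) → ℝ) (hD2 : ∀ x, D2 x = (x - μ) ⬝ᵥ (S⁻¹ *ᵥ (x - μ))) :
    (∀ ω, 0 ≤ W ω → D2 (X ω) = W ω * ∑ i, (Z ω i) ^ 2) ∧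
    (∀ x : ℝ, 0 ≤ x →
      ℙ {ω | D2 (X ω) ≤ x} =
        ∫⁻ w, gammaMeasure ((d : ℝ) / 2) (1 / 2) (Set.Iic (x / w))
          ∂(Measure.map W ℙ)) := by

  have h1 : ∀ ω, 0 ≤ W ω → D2 (X ω) = W ω * ∑ i, (Z ω i) ^ 2 := by
    intro ω hω
    have hAT : IsUnit (Aᵀ).det := by rwa [det_transpose]
    rw [hD2, hX, add_sub_cancel_left, hSdef, Matrix.mul_inv_rev, mulVec_smul, mulVec_mulVec,
      Matrix.mul_assoc, Matrix.nonsing_inv_mul _ hA, Matrix.mul_one, smul_dotProduct,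
      dotProduct_smul, smul_smul, mul_self_sqrt hω, smul_eq_mul, dotProduct_mulVec,
      ← mulVec_transpose, mulVec_mulVec, transpose_nonsing_inv, transpose_transpose,
      Matrix.nonsing_inv_mul _ hA, one_mulVec]
    simp [dotProduct, sq]
  refine ⟨h1, fun x hx => ?_⟩
  have hS : Measurable (fun z : Fin d → ℝ => ∑ i, z i ^ 2) := by fun_prop
  have hset : MeasurableSet {p : ℝ × (Fin d → ℝ) | p.1 * ∑ i, p.2 i ^ 2 ≤ x} :=
    measurableSet_le (by fun_prop) measurable_const
  calc ℙ {ω | D2 (X ω) ≤ x}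
      = ℙ ((fun ω => (W ω, Z ω)) ⁻¹' {p : ℝ × (Fin d → ℝ) | p.1 * ∑ i, p.2 i ^ 2 ≤ x}) := by
        apply measure_congr
        filter_upwards [hWpos] with ω hω
        apply propext
        change D2 (X ω) ≤ x ↔ W ω * ∑ i, Z ω i ^ 2 ≤ x
        rw [h1 ω hω.le]
    _ = ((Measure.map W ℙ).prod (Measure.map Z ℙ))
          {p : ℝ × (Fin d → ℝ) | p.1 * ∑ i, p.2 i ^ 2 ≤ x} := by
        rw [← (indepFun_iff_map_prod_eq_prod_map_map hW.aemeasurable hZ.aemeasurable).1 hindep,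
          Measure.map_apply (hW.prodMk hZ) hset]
    _ = _ := by
        have : IsProbabilityMeasure (Measure.map Z ℙ) :=
          Measure.isProbabilityMeasure_map hZ.aemeasurable
        rw [Measure.prod_apply hset]
        apply lintegral_congr_ae
        have hpos : ∀ᵐ w ∂(Measure.map W ℙ), 0 < w :=
          (ae_map_iff hW.aemeasurable measurableSet_Ioi).2 hWpos
        filter_upwards [hpos] with w hw
        rw [← aux_law d hd, Measure.map_apply hS measurableSet_Iic, hZlaw]
        congr 1
        ext z
        simp [le_div_iff₀ hw, mul_comm]
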